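/- In any 3-quasi-Sasakian manifold of rank 4l+3 the Riemannian curvature tensor R satisfies: (i) R(X,Y)ξ_α = 0 for all X, Y ∈ Γ(E^{4m}) and all α; (ii) R(X, ξ_β)ξ_α = 0 for all X ∈ Γ(E^{4m}) and all α, β; (iii) R(X, ξ_α)ξ_α = (c²/4) X for all X ∈ Γ(E^{4l}) and all α; (iv) R(X, ξ_β)ξ_α = 0 for all X ∈ Γ(E^{4l}) and α ≠ β. Consequently the sectional curvatures satisfy K(ξ_α, X) = 0 for X ∈ Γ(E^{4m}) and K(ξ_α, X) = (c²/4)‖X‖² for unit X ∈ Γ(E^{4l}). -/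

import Mathlib

/-!
An abstract (Lie–Rinehart style) algebraic model of the differential geometry of
almost contact metric 3-structures: `F` plays the role of the algebra of smooth
functions on a manifold `M` of dimension `4n+3`, and `V` plays the role of the
`F`-module of smooth vector fields, acting on `F` by derivations and carrying a
Lie bracket, a Riemannian metric `g`, and three almost contact metric structures
`(φ_α, ξ_α, η_α, g)`.
-/

noncomputable section

namespace QS3

/-- Cyclic (= even) permutations of `{0,1,2}`, modelling even permutations of `{1,2,3}`. -/
def Cyclic (a b c : Fin 3) : Prop :=
  (a, b, c) = (0, 1, 2) ∨ (a, b, c) = (1, 2, 0) ∨ (a, b, c) = (2, 0, 1)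

/-- The algebraic model of the smooth structure of a manifold: an `ℝ`-algebra `F`
of smooth functions and an `F`-module `V` of vector fields acting on `F` by
derivations and carrying the Lie bracket of vector fields. -/
class SmoothSetting (F : Type) (V : Type) [CommRing F] [Algebra ℝ F]
    [AddCommGroup V] [Module F V] where
  act : V → F → F
  bracket : V → V → V
  act_add : ∀ (X : V) (f₁ f₂ : F), act X (f₁ + f₂) = act X f₁ + act X f₂
  act_mul : ∀ (X : V) (f₁ f₂ : F), act X (f₁ * f₂) = act X f₁ * f₂ + f₁ * act X f₂
  act_const : ∀ (X : V) (r : ℝ), act X (algebraMap ℝ F r) = 0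
  act_addLeft : ∀ (X Y : V) (f : F), act (X + Y) f = act X f + act Y f
  act_smulLeft : ∀ (f : F) (X : V) (h : F), act (f • X) h = f * act X h
  bracket_antisymm : ∀ X Y : V, bracket X Y = -bracket Y X
  bracket_addLeft : ∀ X Y Z : V, bracket (X + Y) Z = bracket X Z + bracket Y Z
  bracket_act : ∀ (X Y : V) (f : F),
    act (bracket X Y) f = act X (act Y f) - act Y (act X f)
  bracket_smulRight : ∀ (X : V) (f : F) (Y : V),
    bracket X (f • Y) = f • bracket X Y + act X f • Y
  jacobi : ∀ X Y Z : V,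
    bracket X (bracket Y Z) + bracket Y (bracket Z X) + bracket Z (bracket X Y) = 0

section d

variable (F V : Type) [CommRing F] [Algebra ℝ F] [AddCommGroup V] [Module F V]
  [SmoothSetting F V]

/-- The action of a vector field on a function (directional derivative). -/
def der (X : V) (f : F) : F := SmoothSetting.act X f

/-- The Lie bracket of vector fields. -/
def lie (X Y : V) : V := SmoothSetting.bracket F X Y

/-- Exterior differential of a 1-form (with the `1/2` normalization convention,
so that `2 dθ(X,Y) = X θ(Y) - Y θ(X) - θ([X,Y])`). -/
def dOne (θ : V → F) (X Y : V) : F :=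
  (2 : ℝ)⁻¹ • (der F V X (θ Y) - der F V Y (θ X) - θ (lie F V X Y))

/-- Exterior differential of a 2-form (with the `1/3` normalization convention). -/
def dTwo (ω : V → V → F) (X Y Z : V) : F :=
  (3 : ℝ)⁻¹ • (der F V X (ω Y Z) + der F V Y (ω Z X) + der F V Z (ω X Y)
    - ω (lie F V X Y) Z - ω (lie F V Y Z) X - ω (lie F V Z X) Y)

end d

/-- An almost contact metric 3-structure on a manifold of dimension `4n+3`:
three almost contact metric structures `(φ_α, ξ_α, η_α, g)` satisfying the
quaternionic-type relations, together with a (local) orthonormal frame. -/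
class ACM3 (F V : Type) [CommRing F] [Algebra ℝ F] [AddCommGroup V] [Module F V]
    [SmoothSetting F V] where
  n : ℕ
  g : V → V → F
  phi : Fin 3 → V → V
  xi : Fin 3 → V
  eta : Fin 3 → V → F
  g_symm : ∀ X Y, g X Y = g Y X
  g_addLeft : ∀ X Y Z, g (X + Y) Z = g X Z + g Y Z
  g_smulLeft : ∀ (f : F) (X Y : V), g (f • X) Y = f * g X Y
  g_nondeg : ∀ X, (∀ Y, g X Y = 0) → X = 0
  phi_add : ∀ α (X Y : V), phi α (X + Y) = phi α X + phi α Y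
  phi_smul : ∀ α (f : F) (X : V), phi α (f • X) = f • phi α X
  eta_eq : ∀ α X, eta α X = g X (xi α)
  acm_sq : ∀ α X, phi α (phi α X) = -X + eta α X • xi α
  eta_xi : ∀ α, eta α (xi α) = 1
  compat : ∀ α X Y, g (phi α X) (phi α Y) = g X Y - eta α X * eta α Y
  quat_phi : ∀ a b c, Cyclic a b c → ∀ X, phi c X = phi a (phi b X) - eta b X • xi a
  quat_phi' : ∀ a b c, Cyclic a b c → ∀ X, phi c X = -(phi b (phi a X)) + eta a X • xi b
  quat_xi : ∀ a b c, Cyclic a b c → xi c = phi a (xi b)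
  quat_xi' : ∀ a b c, Cyclic a b c → xi c = -(phi b (xi a))
  quat_eta : ∀ a b c, Cyclic a b c → ∀ X, eta c X = eta a (phi b X)
  quat_eta' : ∀ a b c, Cyclic a b c → ∀ X, eta c X = -(eta b (phi a X))
  frame : Fin (4 * n + 3) → V
  frame_orth : ∀ i j, g (frame i) (frame j) = if i = j then 1 else 0
  frame_span : ∀ X : V, X = ∑ i, g X (frame i) • frame i

section acm

variable (F V : Type) [CommRing F] [Algebra ℝ F] [AddCommGroup V] [Module F V]
  [SmoothSetting F V] [ACM3 F V]

/-- The integer `n` (the manifold has dimension `4n+3`). -/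
def dimn : ℕ := ACM3.n F V

/-- The Riemannian metric. -/
def gm (X Y : V) : F := ACM3.g X Y

/-- The structure tensors `φ_α`. -/
def ph (α : Fin 3) (X : V) : V := ACM3.phi F α X

/-- The Reeb vector fields `ξ_α`. -/
def rxi (α : Fin 3) : V := ACM3.xi F α

/-- The 1-forms `η_α`. -/
def et (α : Fin 3) (X : V) : F := ACM3.eta α X

/-- The orthonormal frame. -/
def fr (i : Fin (4 * dimn F V + 3)) : V := ACM3.frame i

/-- The fundamental 2-form `Φ_α(X,Y) = g(X, φ_α Y)`. -/
def Phi (α : Fin 3) (X Y : V) : F := gm F V X (ph F V α Y)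

/-- The Nijenhuis torsion `[φ_α, φ_α]` of `φ_α`. -/
def Nij (α : Fin 3) (X Y : V) : V :=
  ph F V α (ph F V α (lie F V X Y)) + lie F V (ph F V α X) (ph F V α Y)
    - ph F V α (lie F V (ph F V α X) Y) - ph F V α (lie F V X (ph F V α Y))

/-- The normality tensor `N⁽¹⁾_α = [φ_α, φ_α] + 2 dη_α ⊗ ξ_α`. -/
def NOne (α : Fin 3) (X Y : V) : V :=
  Nij F V α X Y + ((2 : ℝ) • dOne F V (et F V α) X Y) • rxi F V α

/-- The structure `(φ_α, ξ_α, η_α)` is normal. -/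
def IsNormal (α : Fin 3) : Prop := ∀ X Y, NOne F V α X Y = 0

/-- A 2-form is closed. -/
def IsClosedTwo (ω : V → V → F) : Prop := ∀ X Y Z, dTwo F V ω X Y Z = 0

/-- The structure `(φ_α, ξ_α, η_α, g)` is quasi-Sasakian: normal with closed
fundamental 2-form. -/
def IsQuasiSasakian (α : Fin 3) : Prop :=
  IsNormal F V α ∧ IsClosedTwo F V (Phi F V α)

/-- `M` is 3-cosymplectic: each structure is normal with `dη_α = 0` and `dΦ_α = 0`. -/
def ThreeCosymplectic : Prop :=
  ∀ α, IsNormal F V α ∧ (∀ X Y, dOne F V (et F V α) X Y = 0) ∧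
    IsClosedTwo F V (Phi F V α)

/-- `M` is 3-α-Sasakian with constant `a ≠ 0`: each structure is normal (an
`α`-Sasakian structure) and `dη_δ = a Φ_δ`. -/
def Is3AlphaSasakianWith (a : ℝ) : Prop :=
  a ≠ 0 ∧ (∀ δ, IsNormal F V δ) ∧
    ∀ (δ : Fin 3) (X Y : V), dOne F V (et F V δ) X Y = algebraMap ℝ F a * Phi F V δ X Y

/-- A vector field is horizontal: it lies in `H = ∩_α ker η_α`. -/
def Horiz (X : V) : Prop := ∀ α, et F V α X = 0

/-- A vector field is vertical: it lies in `V = ⟨ξ₁, ξ₂, ξ₃⟩`. -/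
def InVert (X : V) : Prop :=
  ∃ p q r : F, X = p • rxi F V 0 + q • rxi F V 1 + r • rxi F V 2

/-- The distribution `E^{4m} = {X ∈ H : i_X dη_α = 0}`. -/
def InE4m (X : V) : Prop :=
  Horiz F V X ∧ ∀ (α : Fin 3) (Y : V), dOne F V (et F V α) X Y = 0

/-- The distribution `E^{4l}`: the orthogonal complement of `E^{4m}` in `H`. -/
def InE4l (X : V) : Prop :=
  Horiz F V X ∧ ∀ Y, InE4m F V Y → gm F V X Y = 0

/-- The distribution `E^{4l+3} = E^{4l} ⊕ V`. -/
def InE4l3 (X : V) : Prop :=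
  ∃ Y Z, InE4l F V Y ∧ InVert F V Z ∧ X = Y + Z

/-- The distribution `E^{4m+3} = E^{4m} ⊕ V`. -/
def InE4m3 (X : V) : Prop :=
  ∃ Y Z, InE4m F V Y ∧ InVert F V Z ∧ X = Y + Z

/-- The horizontal component `X_H = X - ∑_α η_α(X) ξ_α` of a vector field. -/
def horComp (X : V) : V := X - ∑ α : Fin 3, et F V α X • rxi F V α

/-- A vector field is basic with respect to the foliation defined by `E^{4m}`. -/
def BasicE4m (X : V) : Prop :=
  InE4l3 F V X ∧ ∀ W, InE4m F V W → InE4m F V (lie F V W X)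

/-- A vector field is basic with respect to the foliation defined by `E^{4l+3}`. -/
def BasicE4l3 (X : V) : Prop :=
  InE4m F V X ∧ ∀ W, InE4l3 F V W → InE4l3 F V (lie F V W X)

end acm

/-- A 3-quasi-Sasakian structure: each of the three almost contact metric
structures is quasi-Sasakian.  We also record, as part of the structure, the
standard structural facts established for such manifolds in the literature
(Cappelletti Montano–De Nicola–Dileo): the Reeb commutation relations
`[ξ_α, ξ_β] = c ξ_γ`, the splitting `H = E^{4l} ⊕ E^{4m}` (constancy of the
rank), the `φ_α`-invariance of both distributions, and the tensors `ψ_α`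
(equal to `φ_α` on `E^{4l+3}` and vanishing on `E^{4m}` when the rank is
`4l+3`, i.e. `c ≠ 0`; equal to `φ_α` on `E^{4l}` and vanishing on `E^{4m+3}`
when the rank is `4l+1`, i.e. `c = 0`). -/
class ThreeQS (F V : Type) [CommRing F] [Algebra ℝ F] [AddCommGroup V] [Module F V]
    [SmoothSetting F V] [ACM3 F V] where
  qs : ∀ α, IsQuasiSasakian F V α
  c : ℝ
  reeb_bracket : ∀ a b c', Cyclic a b c' →
    lie F V (rxi F V a) (rxi F V b) = algebraMap ℝ F c • rxi F V c'
  horiz_split : ∀ X, Horiz F V X → ∃ Y Z, InE4l F V Y ∧ InE4m F V Z ∧ X = Y + Z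
  phi_E4l : ∀ α X, InE4l F V X → InE4l F V (ph F V α X)
  phi_E4m : ∀ α X, InE4m F V X → InE4m F V (ph F V α X)
  psi : Fin 3 → V → V
  psi_add : ∀ α (X Y : V), psi α (X + Y) = psi α X + psi α Y
  psi_smul : ∀ α (f : F) (X : V), psi α (f • X) = f • psi α X
  psi_E4l : ∀ α X, InE4l F V X → psi α X = ph F V α X
  psi_E4m : ∀ α X, InE4m F V X → psi α X = 0
  psi_vert_of_ne : c ≠ 0 → ∀ α β, psi α (rxi F V β) = ph F V α (rxi F V β)
  psi_vert_of_eq : c = 0 → ∀ α β, psi α (rxi F V β) = 0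

section tqs

variable (F V : Type) [CommRing F] [Algebra ℝ F] [AddCommGroup V] [Module F V]
  [SmoothSetting F V] [ACM3 F V] [ThreeQS F V]

/-- The constant `c` with `[ξ_α, ξ_β] = c ξ_γ`. -/
def cc : ℝ := ThreeQS.c F V

/-- The tensors `ψ_α`. -/
def psiT (α : Fin 3) (X : V) : V := ThreeQS.psi F α X

/-- The tensors `θ_α = φ_α - ψ_α`. -/
def thetaT (α : Fin 3) (X : V) : V := ph F V α X - psiT F V α X

/-- The 2-forms `Θ_α(X,Y) = g(X, θ_α Y)`. -/
def ThetaForm (α : Fin 3) (X Y : V) : F := gm F V X (thetaT F V α Y)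

end tqs

/-- The 3-quasi-Sasakian manifold has rank `4l+3`: the constant `c` is nonzero
and the orthonormal frame is adapted to the splitting
`TM = E^{4l} ⊕ E^{4m} ⊕ ⟨ξ₁,ξ₂,ξ₃⟩` with `dim E^{4l} = 4l` (hence
`dim E^{4m} = 4m`, `m = n - l`, and the rank of the `η_α` is `4l+3`). -/
class HasRank (F V : Type) [CommRing F] [Algebra ℝ F] [AddCommGroup V] [Module F V]
    [SmoothSetting F V] [ACM3 F V] [ThreeQS F V] (l : ℕ) : Prop where
  c_ne : cc F V ≠ 0
  l_le : l ≤ dimn F V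
  frame_E4l : ∀ i : Fin (4 * dimn F V + 3), i.val < 4 * l → InE4l F V (fr F V i)
  frame_E4m : ∀ i : Fin (4 * dimn F V + 3), 4 * l ≤ i.val → i.val < 4 * dimn F V →
    InE4m F V (fr F V i)
  frame_xi : ∀ (i : Fin (4 * dimn F V + 3)) (a : Fin 3),
    i.val = 4 * dimn F V + a.val → fr F V i = rxi F V a

/-- The Levi-Civita connection of `g`: the unique torsion-free metric connection. -/
class LeviCivita (F V : Type) [CommRing F] [Algebra ℝ F] [AddCommGroup V] [Module F V]
    [SmoothSetting F V] [ACM3 F V] where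
  nabla : V → V → V
  nabla_addLeft : ∀ X Y Z : V, nabla (X + Y) Z = nabla X Z + nabla Y Z
  nabla_smulLeft : ∀ (f : F) (X Y : V), nabla (f • X) Y = f • nabla X Y
  nabla_addRight : ∀ X Y Z : V, nabla X (Y + Z) = nabla X Y + nabla X Z
  nabla_leibniz : ∀ (X : V) (f : F) (Y : V),
    nabla X (f • Y) = der F V X f • Y + f • nabla X Y
  nabla_metric : ∀ X Y Z : V,
    der F V X (gm F V Y Z) = gm F V (nabla X Y) Z + gm F V Y (nabla X Z)
  nabla_torsionFree : ∀ X Y : V, nabla X Y - nabla Y X = lie F V X Y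

section curv

variable (F V : Type) [CommRing F] [Algebra ℝ F] [AddCommGroup V] [Module F V]
  [SmoothSetting F V] [ACM3 F V] [LeviCivita F V]

/-- The Levi-Civita covariant derivative `∇_X Y`. -/
def nab (X Y : V) : V := LeviCivita.nabla F X Y

/-- The Riemannian curvature `R(X,Y)Z = ∇_X ∇_Y Z - ∇_Y ∇_X Z - ∇_{[X,Y]} Z`. -/
def Rcurv (X Y Z : V) : V :=
  nab F V X (nab F V Y Z) - nab F V Y (nab F V X Z) - nab F V (lie F V X Y) Z

/-- The Ricci tensor `Ric(X,Y) = ∑_i g(R(e_i, X)Y, e_i)`. -/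
def Ric (X Y : V) : F :=
  ∑ i, gm F V (Rcurv F V (fr F V i) X Y) (fr F V i)

/-- The scalar curvature. -/
def Scal : F := ∑ i, Ric F V (fr F V i) (fr F V i)

/-- `M` is Einstein: `Ric = a g` for a constant `a`. -/
def Einstein : Prop :=
  ∃ a : ℝ, ∀ X Y, Ric F V X Y = algebraMap ℝ F a * gm F V X Y

/-- `M` is η-Einstein: `Ric = a g + b ∑_α η_α ⊗ η_α` for constants `a, b`. -/
def EtaEinstein : Prop :=
  ∃ a b : ℝ, ∀ X Y, Ric F V X Y
    = algebraMap ℝ F a * gm F V X Y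
      + algebraMap ℝ F b * ∑ α : Fin 3, et F V α X * et F V α Y

end curv

/-- A (Koszul) linear connection on vector fields. -/
def IsConnection (F V : Type) [CommRing F] [Algebra ℝ F] [AddCommGroup V] [Module F V]
    [SmoothSetting F V] (D : V → V → V) : Prop :=
  (∀ X Y Z : V, D (X + Y) Z = D X Z + D Y Z) ∧
  (∀ (f : F) (X Y : V), D (f • X) Y = f • D X Y) ∧
  (∀ X Y Z : V, D X (Y + Z) = D X Y + D X Z) ∧
  (∀ (X : V) (f : F) (Y : V), D X (f • Y) = der F V X f • Y + f • D X Y)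

end QS3

namespace QS3

section curvature

variable {F V : Type} [CommRing F] [Algebra ℝ F] [AddCommGroup V] [Module F V]

theorem two_mul_cancel_scalar {f h : F} (e : (2 : F) * f = 2 * h) : f = h := by
  have h2 : algebraMap ℝ F (1 / 2) * 2 = 1 := by
    rw [← map_ofNat (algebraMap ℝ F) 2, ← map_mul]; norm_num
  linear_combination algebraMap ℝ F (1 / 2) * e - (f - h) * h2

theorem two_smul_cancel {X Y : V} (e : (2 : F) • X = (2 : F) • Y) : X = Y := by
  have h2 : algebraMap ℝ F (1 / 2) * 2 = 1 := by
    rw [← map_ofNat (algebraMap ℝ F) 2, ← map_mul]; norm_num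
  have := congrArg (fun Z => algebraMap ℝ F (1 / 2) • Z) e
  simpa only [smul_smul, h2, one_smul] using this

variable [SmoothSetting F V]

local notation "𝔇" => der F V
local notation "𝔏" => lie F V

theorem der_add (X : V) (f h : F) : 𝔇 X (f + h) = 𝔇 X f + 𝔇 X h :=
  SmoothSetting.act_add X f h

theorem der_mul (X : V) (f h : F) : 𝔇 X (f * h) = 𝔇 X f * h + f * 𝔇 X h :=
  SmoothSetting.act_mul X f h

theorem der_const (X : V) (r : ℝ) : 𝔇 X (algebraMap ℝ F r) = 0 :=
  SmoothSetting.act_const X r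

theorem der_zero (X : V) : 𝔇 X (0 : F) = 0 := by
  simpa using der_const (F := F) X 0

theorem der_one (X : V) : 𝔇 X (1 : F) = 0 := by
  simpa using der_const (F := F) X 1

theorem der_const_mul (X : V) (r : ℝ) (f : F) :
    𝔇 X (algebraMap ℝ F r * f) = algebraMap ℝ F r * 𝔇 X f := by
  rw [der_mul, der_const]; ring

theorem der_neg (X : V) (f : F) : 𝔇 X (-f) = -𝔇 X f := by
  simpa using der_const_mul X (-1) f

theorem der_lie (X Y : V) (f : F) : 𝔇 (𝔏 X Y) f = 𝔇 X (𝔇 Y f) - 𝔇 Y (𝔇 X f) :=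
  SmoothSetting.bracket_act X Y f

theorem lie_antisymm (X Y : V) : 𝔏 X Y = -𝔏 Y X := SmoothSetting.bracket_antisymm X Y

theorem lie_self_eq_zero (X : V) : 𝔏 X X = 0 := by
  apply two_smul_cancel (F := F)
  linear_combination (norm := module) lie_antisymm (F := F) X X

theorem lie_smul_right (X : V) (f : F) (Y : V) :
    𝔏 X (f • Y) = f • 𝔏 X Y + 𝔇 X f • Y := SmoothSetting.bracket_smulRight X f Y

theorem lie_const_smul_right (X : V) (r : ℝ) (Y : V) :
    𝔏 X (algebraMap ℝ F r • Y) = algebraMap ℝ F r • 𝔏 X Y := by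
  rw [lie_smul_right, der_const]; simp

theorem lie_neg_right (X Y : V) : 𝔏 X (-Y) = -𝔏 X Y := by
  simpa using lie_const_smul_right (F := F) X (-1) Y

theorem lie_zero_right (X : V) : 𝔏 X 0 = 0 := by
  simpa using lie_const_smul_right (F := F) X 0 0

theorem lie_leibniz (X Y Z : V) : 𝔏 X (𝔏 Y Z) = 𝔏 (𝔏 X Y) Z + 𝔏 Y (𝔏 X Z) := by
  have h : 𝔏 X (𝔏 Y Z) + 𝔏 Y (𝔏 Z X) + 𝔏 Z (𝔏 X Y) = 0 := SmoothSetting.jacobi X Y Z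
  rw [lie_antisymm Z X, lie_neg_right, lie_antisymm Z] at h
  linear_combination (norm := module) h

theorem two_mul_dOne (θ : V → F) (X Y : V) :
    2 * dOne F V θ X Y = 𝔇 X (θ Y) - 𝔇 Y (θ X) - θ (𝔏 X Y) := by
  rw [dOne, Algebra.smul_def, ← mul_assoc, ← map_ofNat (algebraMap ℝ F) 2, ← map_mul]
  norm_num

theorem closedTwo_identity {ω : V → V → F} (h : IsClosedTwo F V ω) (X Y Z : V) :
    𝔇 X (ω Y Z) + 𝔇 Y (ω Z X) + 𝔇 Z (ω X Y)
      - ω (𝔏 X Y) Z - ω (𝔏 Y Z) X - ω (𝔏 Z X) Y = 0 := by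
  have h3 := congrArg (fun f => (3 : ℝ) • f) (h X Y Z)
  simpa [dTwo, smul_smul] using h3

variable [ACM3 F V]

local notation "𝔤" => gm F V
local notation "φ" => ph F V
local notation "ξ" => rxi F V
local notation "η" => et F V

theorem Cyclic.rotate {a b c : Fin 3} (h : Cyclic a b c) : Cyclic b c a := by
  revert h; revert a b c; unfold Cyclic; decide

theorem exists_cyclic (a : Fin 3) : ∃ b c, Cyclic a b c := by
  revert a; unfold Cyclic; decide

theorem exists_cyclic_of_ne {a b : Fin 3} (h : a ≠ b) :
    ∃ c, Cyclic a b c ∨ Cyclic b a c := by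
  revert a b; unfold Cyclic; decide

theorem gm_symm (X Y : V) : 𝔤 X Y = 𝔤 Y X := ACM3.g_symm X Y

theorem gm_add_left (X Y Z : V) : 𝔤 (X + Y) Z = 𝔤 X Z + 𝔤 Y Z := ACM3.g_addLeft X Y Z

theorem gm_smul_left (f : F) (X Y : V) : 𝔤 (f • X) Y = f * 𝔤 X Y := ACM3.g_smulLeft f X Y

theorem gm_add_right (X Y Z : V) : 𝔤 X (Y + Z) = 𝔤 X Y + 𝔤 X Z := by
  rw [gm_symm, gm_add_left, gm_symm Y, gm_symm Z]

theorem gm_smul_right (f : F) (X Y : V) : 𝔤 X (f • Y) = f * 𝔤 X Y := by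
  rw [gm_symm, gm_smul_left, gm_symm Y]

theorem gm_neg_left (X Y : V) : 𝔤 (-X) Y = -𝔤 X Y := by
  simpa using gm_smul_left (-1 : F) X Y

theorem gm_neg_right (X Y : V) : 𝔤 X (-Y) = -𝔤 X Y := by
  simpa using gm_smul_right (-1 : F) X Y

theorem gm_sub_left (X Y Z : V) : 𝔤 (X - Y) Z = 𝔤 X Z - 𝔤 Y Z := by
  rw [sub_eq_add_neg, gm_add_left, gm_neg_left, sub_eq_add_neg]

theorem gm_sub_right (X Y Z : V) : 𝔤 X (Y - Z) = 𝔤 X Y - 𝔤 X Z := by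
  rw [sub_eq_add_neg, gm_add_right, gm_neg_right, sub_eq_add_neg]

theorem gm_zero_left (X : V) : 𝔤 0 X = 0 := by
  simpa using gm_smul_left (0 : F) 0 X

theorem gm_zero_right (X : V) : 𝔤 X 0 = 0 := by
  rw [gm_symm, gm_zero_left]

theorem eq_zero_of_gm {X : V} (h : ∀ Y, 𝔤 X Y = 0) : X = 0 :=
  ACM3.g_nondeg (F := F) X h

theorem eq_of_gm {X Y : V} (h : ∀ Z, 𝔤 X Z = 𝔤 Y Z) : X = Y :=
  sub_eq_zero.1 (eq_zero_of_gm (F := F) fun Z => by rw [gm_sub_left, h, sub_self])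

theorem et_eq (α : Fin 3) (X : V) : η α X = 𝔤 X (ξ α) := ACM3.eta_eq α X

theorem ph_add (α : Fin 3) (X Y : V) : φ α (X + Y) = φ α X + φ α Y := ACM3.phi_add α X Y

theorem ph_smul (α : Fin 3) (f : F) (X : V) : φ α (f • X) = f • φ α X := ACM3.phi_smul α f X

theorem ph_neg (α : Fin 3) (X : V) : φ α (-X) = -φ α X := by
  simpa using ph_smul α (-1 : F) X

theorem ph_zero (α : Fin 3) : φ α 0 = 0 := by
  simpa using ph_smul α (0 : F) (0 : V)

theorem ph_sub (α : Fin 3) (X Y : V) : φ α (X - Y) = φ α X - φ α Y := by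
  rw [sub_eq_add_neg, ph_add, ph_neg, sub_eq_add_neg]

theorem ph_ph (α : Fin 3) (X : V) : φ α (φ α X) = -X + η α X • ξ α := ACM3.acm_sq α X

theorem et_rxi_self (α : Fin 3) : η α (ξ α) = 1 := ACM3.eta_xi α

theorem et_add (α : Fin 3) (X Y : V) : η α (X + Y) = η α X + η α Y := by
  simp only [et_eq, gm_add_left]

theorem et_neg (α : Fin 3) (X : V) : η α (-X) = -η α X := by
  simp only [et_eq, gm_neg_left]

theorem et_smul (α : Fin 3) (f : F) (X : V) : η α (f • X) = f * η α X := by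
  simp only [et_eq, gm_smul_left]

theorem et_zero (α : Fin 3) : η α 0 = 0 := by rw [et_eq, gm_zero_left]

theorem ph_eq_comp {a b c : Fin 3} (h : Cyclic a b c) (X : V) :
    φ c X = φ a (φ b X) - η b X • ξ a := ACM3.quat_phi a b c h X

theorem ph_eq_neg_comp {a b c : Fin 3} (h : Cyclic a b c) (X : V) :
    φ c X = -φ b (φ a X) + η a X • ξ b := ACM3.quat_phi' a b c h X

theorem ph_rxi_next {a b c : Fin 3} (h : Cyclic a b c) : φ a (ξ b) = ξ c :=
  (ACM3.quat_xi (F := F) a b c h).symm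

theorem ph_rxi_prev {a b c : Fin 3} (h : Cyclic a b c) : φ b (ξ a) = -ξ c := by
  have : ξ c = -φ b (ξ a) := ACM3.quat_xi' (F := F) a b c h
  rw [this, neg_neg]

theorem et_ph_next {a b c : Fin 3} (h : Cyclic a b c) (X : V) : η a (φ b X) = η c X :=
  (ACM3.quat_eta a b c h X).symm

theorem et_ph_prev {a b c : Fin 3} (h : Cyclic a b c) (X : V) : η b (φ a X) = -η c X := by
  have : η c X = -η b (φ a X) := ACM3.quat_eta' a b c h X
  rw [this, neg_neg]

theorem et_next_rxi {a b c : Fin 3} (h : Cyclic a b c) : η b (ξ a) = 0 := by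
  have h1 := ph_eq_comp (F := F) h (ξ a)
  rw [ph_rxi_next h.rotate.rotate, ph_rxi_prev h, ph_neg, ph_rxi_prev h.rotate.rotate,
    neg_neg] at h1
  have h2 : η b (ξ a) • ξ a = 0 := by linear_combination (norm := module) h1
  have h3 := congrArg (η a) h2
  simpa [et_smul, et_rxi_self, et_zero] using h3

theorem et_rxi_of_ne {α β : Fin 3} (h : α ≠ β) : η α (ξ β) = 0 := by
  obtain ⟨γ, h | h⟩ := exists_cyclic_of_ne h
  · rw [et_eq, gm_symm, ← et_eq, et_next_rxi h]
  · exact et_next_rxi h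

theorem ph_rxi_self (α : Fin 3) : φ α (ξ α) = 0 := by
  obtain ⟨β, γ, h⟩ := exists_cyclic α
  have h0 : φ α (φ α (ξ α)) = 0 := by rw [ph_ph, et_rxi_self]; simp
  have h1 : φ α (ξ α) = η α (φ α (ξ α)) • ξ α := by
    have := ph_ph (F := F) α (φ α (ξ α))
    rw [h0, ph_zero] at this
    linear_combination (norm := module) this
  have h2 := ph_eq_neg_comp (F := F) h (ξ α)
  rw [ph_rxi_next h.rotate.rotate, et_rxi_self, h1, ph_smul, ph_rxi_prev h] at h2
  have h3 : η α (φ α (ξ α)) • ξ γ = 0 := by linear_combination (norm := module) -h2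
  have h4 := congrArg (η γ) h3
  rw [et_smul, et_rxi_self, et_zero, mul_one] at h4
  rw [h1, h4, zero_smul]

theorem et_ph_self (α : Fin 3) (X : V) : η α (φ α X) = 0 := by
  have h := congrArg (φ α) (ph_ph (F := F) α X)
  rw [ph_ph α (φ α X), ph_add, ph_smul, ph_rxi_self, ph_neg] at h
  have h' : η α (φ α X) • ξ α = 0 := by linear_combination (norm := module) h
  have := congrArg (η α) h'
  simpa [et_smul, et_rxi_self, et_zero] using this

theorem gm_ph_left (α : Fin 3) (X Y : V) : 𝔤 (φ α X) Y = -𝔤 X (φ α Y) := by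
  have h : 𝔤 (φ α X) (φ α (φ α Y)) = 𝔤 X (φ α Y) - η α X * η α (φ α Y) :=
    ACM3.compat α X (φ α Y)
  rw [et_ph_self, ph_ph, gm_add_right, gm_neg_right, gm_smul_right, ← et_eq, et_ph_self] at h
  linear_combination -h

theorem Horiz.ph_ph {X : V} (hX : Horiz F V X) (α : Fin 3) : φ α (φ α X) = -X := by
  rw [QS3.ph_ph, hX α]; simp

theorem Horiz.ph_next {X : V} (hX : Horiz F V X) {a b c : Fin 3} (h : Cyclic a b c) :
    φ a (φ b X) = φ c X := by
  rw [ph_eq_comp (F := F) h, hX b]; simp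

theorem Horiz.ph_prev {X : V} (hX : Horiz F V X) {a b c : Fin 3} (h : Cyclic a b c) :
    φ b (φ a X) = -φ c X := by
  rw [ph_eq_neg_comp (F := F) h, hX a]; simp

theorem Horiz.add {X Y : V} (hX : Horiz F V X) (hY : Horiz F V Y) : Horiz F V (X + Y) :=
  fun α => by rw [et_add, hX α, hY α, add_zero]

theorem Horiz.smul {X : V} (hX : Horiz F V X) (f : F) : Horiz F V (f • X) :=
  fun α => by rw [et_smul, hX α, mul_zero]

theorem horiz_horComp (X : V) : Horiz F V (horComp F V X) := by
  intro α
  rw [horComp, Fin.sum_univ_three, sub_eq_add_neg]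
  fin_cases α <;> simp [et_add, et_neg, et_smul, et_rxi_self, et_rxi_of_ne]

theorem Horiz.gm_horComp {W : V} (hW : Horiz F V W) (X : V) :
    𝔤 W (horComp F V X) = 𝔤 W X := by
  have := fun α => (et_eq (F := F) α W).symm.trans (hW α)
  simp [horComp, Fin.sum_univ_three, gm_sub_right, gm_add_right, gm_smul_right, this]

theorem Horiz.eq_zero {W : V} (hW : Horiz F V W) (h : ∀ Z, Horiz F V Z → 𝔤 W Z = 0) :
    W = 0 :=
  eq_zero_of_gm (F := F) fun Y => by rw [← hW.gm_horComp, h _ (horiz_horComp Y)]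

theorem IsNormal.dOne_rxi {α : Fin 3} (hN : IsNormal F V α) (X : V) :
    𝔇 X (1 : F) - 𝔇 (ξ α) (η α X) - η α (𝔏 X (ξ α)) = 0 := by
  have h := congrArg (η α) (hN X (ξ α))
  simp only [NOne, Nij, ph_rxi_self, lie_zero_right, ph_zero, et_add, et_smul, et_rxi_self,
    et_ph_self, et_zero, sub_eq_add_neg, et_neg] at h
  have h2 := two_mul_dOne (F := F) (η α) X (ξ α)
  rw [et_rxi_self] at h2
  rw [← h2]
  simpa [two_smul, two_mul] using h

theorem IsNormal.et_lie_rxi {α : Fin 3} (hN : IsNormal F V α) (X : V) :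
    η α (𝔏 (ξ α) X) = 𝔇 (ξ α) (η α X) := by
  have h := hN.dOne_rxi X
  rw [der_one, lie_antisymm, et_neg] at h
  linear_combination h

theorem IsNormal.ph_lie_rxi {α : Fin 3} (hN : IsNormal F V α) (X : V) :
    φ α (𝔏 (ξ α) X) = 𝔏 (ξ α) (φ α X) := by
  have h := hN X (ξ α)
  have h2 := two_mul_dOne (F := F) (η α) X (ξ α)
  rw [et_rxi_self, hN.dOne_rxi] at h2
  have h3 : (2 : ℝ) • dOne F V (η α) X (ξ α) = 0 := by
    simpa [two_smul, two_mul] using h2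
  simp only [NOne, h3, Nij, ph_rxi_self, lie_zero_right, ph_zero, zero_smul, add_zero,
    sub_zero] at h
  rw [lie_antisymm X, lie_antisymm (φ α X), ph_neg, ph_neg, ph_neg] at h
  have h4 := congrArg (φ α) h
  simp only [ph_sub, ph_neg, ph_zero, ph_add, ph_smul, ph_rxi_self, smul_zero,
    ph_ph α (𝔏 _ _), et_ph_self, hN.et_lie_rxi, der_zero, zero_smul, add_zero] at h4
  linear_combination (norm := module) h4

theorem Phi_eq (α : Fin 3) (X Y : V) : Phi F V α X Y = 𝔤 X (φ α Y) := rfl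

theorem IsClosedTwo.lieDer_Phi {β : Fin 3} (hc : IsClosedTwo F V (Phi F V β)) (Z X Y : V) :
    𝔇 Z (𝔤 X (φ β Y)) - 𝔤 (𝔏 Z X) (φ β Y) - 𝔤 X (φ β (𝔏 Z Y))
      = 𝔇 X (𝔤 Z (φ β Y)) - 𝔇 Y (𝔤 Z (φ β X)) - 𝔤 Z (φ β (𝔏 X Y)) := by
  have h := closedTwo_identity hc Z X Y
  have skew : ∀ U W : V, Phi F V β U W = -𝔤 W (φ β U) := fun U W => by
    rw [Phi_eq, gm_symm, gm_ph_left]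
  rw [skew Y Z, skew (𝔏 X Y) Z, skew (𝔏 Y Z) X, lie_antisymm Y Z, ph_neg, gm_neg_right,
    der_neg] at h
  simp only [Phi_eq] at h
  linear_combination h

/-- The Reeb vector field of a quasi-Sasakian structure is Killing. -/
theorem IsQuasiSasakian.killing {α : Fin 3} (hq : IsQuasiSasakian F V α) (X Y : V) :
    𝔇 (ξ α) (𝔤 X Y) = 𝔤 (𝔏 (ξ α) X) Y + 𝔤 X (𝔏 (ξ α) Y) := by
  have hz : ∀ W, 𝔤 (ξ α) (φ α W) = 0 := fun W => by rw [gm_symm, ← et_eq, et_ph_self]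
  have h1 := hq.2.lieDer_Phi (ξ α) X (φ α Y)
  simp only [hz, der_zero, ← hq.1.ph_lie_rxi] at h1
  simp only [ph_ph, gm_add_right, gm_neg_right, gm_smul_right, ← et_eq, hq.1.et_lie_rxi,
    der_add, der_mul, der_neg] at h1
  linear_combination -h1

theorem lie_rxi_self (a : Fin 3) : 𝔏 (ξ a) (ξ a) = algebraMap ℝ F 0 • ξ a := by
  rw [lie_self_eq_zero, map_zero, zero_smul]

local notation "∇" => nab F V
local notation "κ" => algebraMap ℝ F (cc F V)

section threeQS

variable [ThreeQS F V]

theorem killing (α : Fin 3) (X Y : V) :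
    𝔇 (ξ α) (𝔤 X Y) = 𝔤 (𝔏 (ξ α) X) Y + 𝔤 X (𝔏 (ξ α) Y) :=
  (ThreeQS.qs (F := F) (V := V) α).killing X Y

theorem lie_rxi_next {a b c : Fin 3} (h : Cyclic a b c) : 𝔏 (ξ a) (ξ b) = κ • ξ c :=
  ThreeQS.reeb_bracket a b c h

theorem lie_rxi_prev {a b c : Fin 3} (h : Cyclic a b c) :
    𝔏 (ξ b) (ξ a) = algebraMap ℝ F (-cc F V) • ξ c := by
  rw [lie_antisymm, lie_rxi_next h, map_neg, neg_smul]

theorem exists_lie_rxi (α β : Fin 3) :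
    ∃ (r : ℝ) (γ : Fin 3), 𝔏 (ξ α) (ξ β) = algebraMap ℝ F r • ξ γ := by
  by_cases h : α = β
  · subst h; exact ⟨_, _, lie_rxi_self α⟩
  · obtain ⟨γ, h | h⟩ := exists_cyclic_of_ne h
    · exact ⟨_, _, lie_rxi_next h⟩
    · exact ⟨_, _, lie_rxi_prev h⟩

theorem Horiz.lie_rxi {X : V} (hX : Horiz F V X) (α : Fin 3) : Horiz F V (𝔏 (ξ α) X) := by
  intro β
  obtain ⟨r, γ, h⟩ := exists_lie_rxi (F := F) (V := V) α β
  have hk := killing (F := F) α X (ξ β)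
  rw [h, gm_smul_right, ← et_eq, ← et_eq, ← et_eq, hX, hX, der_zero] at hk
  linear_combination -hk

end threeQS

variable [LeviCivita F V]

theorem nab_add_left (X Y Z : V) : ∇ (X + Y) Z = ∇ X Z + ∇ Y Z := LeviCivita.nabla_addLeft X Y Z

theorem nab_smul_left (f : F) (X Y : V) : ∇ (f • X) Y = f • ∇ X Y :=
  LeviCivita.nabla_smulLeft f X Y

theorem nab_neg_left (X Y : V) : ∇ (-X) Y = -∇ X Y := by
  simpa using nab_smul_left (-1 : F) X Y

theorem nab_zero_left (Y : V) : ∇ 0 Y = 0 := by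
  simpa using nab_smul_left (0 : F) (0 : V) Y

theorem nab_const_smul_right (X : V) (r : ℝ) (Y : V) :
    ∇ X (algebraMap ℝ F r • Y) = algebraMap ℝ F r • ∇ X Y := by
  have h : ∇ X (algebraMap ℝ F r • Y) = 𝔇 X (algebraMap ℝ F r) • Y + algebraMap ℝ F r • ∇ X Y :=
    LeviCivita.nabla_leibniz X _ Y
  rw [h, der_const, zero_smul, zero_add]

theorem nab_zero_right (X : V) : ∇ X 0 = 0 := by
  simpa using nab_const_smul_right (F := F) X 0 0

theorem der_gm (X Y Z : V) : 𝔇 X (𝔤 Y Z) = 𝔤 (∇ X Y) Z + 𝔤 Y (∇ X Z) :=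
  LeviCivita.nabla_metric X Y Z

theorem lie_eq_nab (X Y : V) : 𝔏 X Y = ∇ X Y - ∇ Y X := (LeviCivita.nabla_torsionFree X Y).symm

theorem gm_nab_sub (X Y Z : V) :
    𝔤 (∇ X Z) Y - 𝔤 (∇ Y Z) X = 𝔇 X (𝔤 Y Z) - 𝔇 Y (𝔤 X Z) - 𝔤 (𝔏 X Y) Z := by
  rw [der_gm, der_gm, lie_eq_nab, gm_sub_left, gm_symm Y, gm_symm X]; ring

variable [ThreeQS F V]

theorem gm_nab_rxi (α : Fin 3) (X Y : V) : 𝔤 (∇ X (ξ α)) Y = -𝔤 X (∇ Y (ξ α)) := by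
  have h := killing (F := F) α X Y
  rw [der_gm, lie_eq_nab, lie_eq_nab, gm_sub_left, gm_sub_right] at h
  linear_combination h

theorem two_mul_gm_nab_rxi (α : Fin 3) (X Y : V) :
    2 * 𝔤 (∇ X (ξ α)) Y = 𝔇 X (η α Y) - 𝔇 Y (η α X) - η α (𝔏 X Y) := by
  have h := gm_nab_sub (F := F) X Y (ξ α)
  rw [gm_nab_rxi α Y X, gm_symm Y] at h
  simp only [et_eq]
  linear_combination h

theorem dOne_et (α : Fin 3) (X Y : V) : dOne F V (η α) X Y = 𝔤 (∇ X (ξ α)) Y :=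
  two_mul_cancel_scalar (by rw [two_mul_dOne, two_mul_gm_nab_rxi])

theorem inE4m_iff {X : V} : InE4m F V X ↔ Horiz F V X ∧ ∀ α, ∇ X (ξ α) = 0 := by
  unfold InE4m
  refine and_congr_right fun _ => forall_congr' fun α => ⟨fun h => ?_, fun h Y => ?_⟩
  · exact eq_zero_of_gm (F := F) fun Y => by rw [← dOne_et, h]
  · rw [dOne_et, h, gm_zero_left]

theorem nab_rxi_self (α : Fin 3) : ∇ (ξ α) (ξ α) = 0 := by
  refine eq_zero_of_gm (F := F) fun Y => ?_
  rw [gm_nab_rxi]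
  have h := der_gm (F := F) Y (ξ α) (ξ α)
  rw [← et_eq, et_rxi_self, der_one, gm_symm (∇ Y (ξ α))] at h
  have h' : 𝔤 (ξ α) (∇ Y (ξ α)) = 0 := two_mul_cancel_scalar (by linear_combination -h)
  rw [h', neg_zero]

theorem nab_rxi_antisymm {α β : Fin 3} (hne : α ≠ β) : ∇ (ξ β) (ξ α) = -∇ (ξ α) (ξ β) := by
  refine eq_of_gm (F := F) fun Y => ?_
  rw [gm_neg_left, gm_nab_rxi, gm_nab_rxi]
  have h := der_gm (F := F) Y (ξ β) (ξ α)
  rw [← et_eq, et_rxi_of_ne hne, der_zero, gm_symm (∇ Y (ξ β))] at h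
  linear_combination h

/-- `2 ∇_{ξ_β} ξ_α = -[ξ_α, ξ_β]`. -/
theorem two_smul_nab_rxi (α β : Fin 3) : (2 : F) • ∇ (ξ β) (ξ α) = -𝔏 (ξ α) (ξ β) := by
  by_cases h : α = β
  · subst h; rw [nab_rxi_self, lie_self_eq_zero]; simp
  · rw [lie_eq_nab]
    linear_combination (norm := module) nab_rxi_antisymm (F := F) (V := V) h

theorem Horiz.gm_nab_rxi_rxi {X : V} (hX : Horiz F V X) (α β : Fin 3) :
    𝔤 X (∇ (ξ β) (ξ α)) = 0 := by
  obtain ⟨r, γ, h⟩ := exists_lie_rxi (F := F) (V := V) α β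
  apply two_mul_cancel_scalar
  rw [← gm_smul_right, two_smul_nab_rxi, h, gm_neg_right, gm_smul_right, ← et_eq, hX]
  simp

theorem Horiz.nab_rxi {X : V} (hX : Horiz F V X) (α : Fin 3) : Horiz F V (∇ X (ξ α)) :=
  fun β => by rw [et_eq, QS3.gm_nab_rxi, hX.gm_nab_rxi_rxi, neg_zero]

theorem lie_ph_aux {α β δ : Fin 3} (s : ℝ)
    (hs : ∀ X : V, η α (φ β X) = algebraMap ℝ F s * η δ X) (Y : V) :
    𝔏 (ξ α) (φ β Y) = φ β (𝔏 (ξ α) Y) - (2 : F) • algebraMap ℝ F s • ∇ Y (ξ δ) := by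
  refine eq_of_gm (F := F) fun X => ?_
  have hs' : ∀ W : V, 𝔤 (ξ α) (φ β W) = algebraMap ℝ F s * η δ W := fun W => by
    rw [gm_symm, ← et_eq, hs]
  have h := (ThreeQS.qs (F := F) (V := V) β).2.lieDer_Phi (ξ α) X Y
  rw [hs', hs', hs', der_const_mul, der_const_mul, killing] at h
  have h2 := two_mul_gm_nab_rxi (F := F) δ X Y
  rw [gm_nab_rxi] at h2
  rw [gm_symm, gm_symm _ X, gm_sub_right, gm_smul_right, gm_smul_right]
  linear_combination h - algebraMap ℝ F s * h2

theorem lie_ph_next {a b c : Fin 3} (h : Cyclic a b c) (Y : V) :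
    𝔏 (ξ a) (φ b Y) = φ b (𝔏 (ξ a) Y) - (2 : F) • ∇ Y (ξ c) := by
  have := lie_ph_aux (F := F) (δ := c) 1 (fun X => by rw [et_ph_next h]; simp) Y
  simpa using this

theorem lie_ph_prev {a b c : Fin 3} (h : Cyclic a b c) (Y : V) :
    𝔏 (ξ b) (φ a Y) = φ a (𝔏 (ξ b) Y) + (2 : F) • ∇ Y (ξ c) := by
  have := lie_ph_aux (F := F) (δ := c) (-1) (fun X => by rw [et_ph_prev h]; simp) Y
  simpa using this

theorem Horiz.nab_rxi_eq {X : V} (hX : Horiz F V X) {a b c : Fin 3} (h : Cyclic a b c) :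
    ∇ X (ξ a) = φ b (∇ X (ξ c)) := by
  apply two_smul_cancel (F := F)
  have h1 := lie_ph_next (F := F) h.rotate X
  have h2 := lie_ph_prev (F := F) h X
  have h3 := congrArg (𝔏 (ξ b)) (hX.ph_prev h)
  have h4 := (hX.lie_rxi b).ph_prev h
  have h5 := (ThreeQS.qs (F := F) (V := V) b).1.ph_lie_rxi (φ a X)
  rw [lie_neg_right, ← h5, h2, h1, ph_add, ph_smul, h4] at h3
  linear_combination (norm := module) -h3

/-- A Killing field is affine: its flow commutes with `Z ↦ ∇ Z`, here for `Z = ξ_β`. -/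
theorem lie_nab_rxi {α β δ : Fin 3} {r : ℝ} (h : 𝔏 (ξ α) (ξ β) = algebraMap ℝ F r • ξ δ)
    (X : V) :
    𝔏 (ξ α) (∇ X (ξ β)) = ∇ (𝔏 (ξ α) X) (ξ β) + algebraMap ℝ F r • ∇ X (ξ δ) := by
  have et_lie : ∀ W : V,
      η β (𝔏 (ξ α) W) = 𝔇 (ξ α) (η β W) - algebraMap ℝ F r * η δ W := fun W => by
    have hk := killing (F := F) α W (ξ β)
    rw [h, gm_smul_right] at hk
    simp only [et_eq]
    linear_combination -hk
  refine eq_of_gm (F := F) fun Y => two_mul_cancel_scalar ?_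
  rw [gm_add_left, gm_smul_left]
  have k := congrArg (fun f => (2 : F) * f) (killing (F := F) α (∇ X (ξ β)) Y)
  have h0 := congrArg (𝔇 (ξ α)) (two_mul_gm_nab_rxi (F := F) β X Y)
  have h1 := two_mul_gm_nab_rxi (F := F) β (𝔏 (ξ α) X) Y
  have h2 := two_mul_gm_nab_rxi (F := F) β X (𝔏 (ξ α) Y)
  have h3 := two_mul_gm_nab_rxi (F := F) δ X Y
  have h4 := et_lie (𝔏 X Y)
  rw [lie_leibniz, et_add] at h4
  have two_der : ∀ f : F, 𝔇 (ξ α) (2 * f) = 2 * 𝔇 (ξ α) f := fun f => by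
    simpa only [map_ofNat] using der_const_mul (ξ α) 2 f
  simp only [two_der, sub_eq_add_neg, der_add, der_neg] at h0
  rw [et_lie, der_lie] at h1
  rw [et_lie, der_lie] at h2
  simp only [sub_eq_add_neg, der_add, der_neg, der_const_mul] at h1 h2
  linear_combination h0 - h1 - h2 - k - algebraMap ℝ F r * h3 + h4

theorem Horiz.ph_nab_rxi {X : V} (hX : Horiz F V X) {a b c : Fin 3} (h : Cyclic a b c) :
    φ b (∇ X (ξ b)) = φ c (∇ X (ξ c)) := by
  rw [hX.nab_rxi_eq h.rotate.rotate, (hX.nab_rxi b).ph_next h.rotate.rotate]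

theorem Horiz.nab_nab_rxi_left {X : V} (hX : Horiz F V X) (γ : Fin 3) :
    (2 : F) • ∇ (∇ X (ξ γ)) (ξ γ) + κ • φ γ (∇ X (ξ γ)) = 0 := by
  obtain ⟨α, β, h⟩ := exists_cyclic γ
  have h1 := congrArg (𝔏 (ξ α)) (hX.nab_rxi_eq h.rotate)
  rw [lie_ph_next h.rotate, lie_nab_rxi (lie_rxi_self α),
    lie_nab_rxi (lie_rxi_prev h), (hX.lie_rxi α).nab_rxi_eq h.rotate, ph_add, ph_smul,
    hX.ph_nab_rxi h.rotate, map_neg, map_zero] at h1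
  linear_combination (norm := module) h1

theorem Horiz.nab_nab_rxi_right {X : V} (hX : Horiz F V X) (γ : Fin 3) :
    ∇ ((2 : F) • ∇ X (ξ γ) + κ • φ γ X) (ξ γ) = 0 := by
  have hW : Horiz F V (∇ (φ γ X) (ξ γ)) := fun δ => by
    have hδ : Horiz F V (φ γ X) := by
      intro ε
      by_cases hε : ε = γ
      · rw [hε, et_ph_self]
      · obtain ⟨ζ, h | h⟩ := exists_cyclic_of_ne hε
        · rw [et_ph_next (F := F) h, hX]
        · rw [et_ph_prev h, hX, neg_zero]
    exact hδ.nab_rxi γ δ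
  rw [nab_add_left, nab_smul_left, nab_smul_left]
  refine ((((hX.nab_rxi γ).nab_rxi γ).smul 2).add (hW.smul κ)).eq_zero fun Z hZ => ?_
  have h := congrArg (𝔤 X) (hZ.nab_nab_rxi_left γ)
  rw [gm_add_right, gm_smul_right, gm_smul_right, gm_zero_right] at h
  rw [gm_add_left, gm_smul_left, gm_smul_left, gm_nab_rxi, gm_nab_rxi, gm_nab_rxi, gm_ph_left]
  linear_combination h

/-- On `E^{4l}` one has `∇_X ξ_γ = -(c/2) φ_γ X`. -/
theorem two_smul_nab_rxi_of_inE4l {X : V} (hX : InE4l F V X) (γ : Fin 3) :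
    (2 : F) • ∇ X (ξ γ) = -(κ • φ γ X) := by
  have hφ : InE4l F V (φ γ X) := ThreeQS.phi_E4l γ X hX
  set W := (2 : F) • ∇ X (ξ γ) + κ • φ γ X with hW
  have hWh : Horiz F V W := ((hX.1.nab_rxi γ).smul 2).add (hφ.1.smul κ)
  have hγ : ∇ W (ξ γ) = 0 := hX.1.nab_nab_rxi_right γ
  obtain ⟨α, β, h⟩ := exists_cyclic γ
  have hα : ∇ W (ξ α) = 0 := by rw [hWh.nab_rxi_eq h.rotate, hγ, ph_zero]
  have hβ : ∇ W (ξ β) = 0 := by rw [hWh.nab_rxi_eq h.rotate.rotate, hα, ph_zero]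
  have hWm : InE4m F V W := by
    refine inE4m_iff.2 ⟨hWh, fun δ => ?_⟩
    have : δ = γ ∨ δ = α ∨ δ = β := by
      clear hγ hα hβ hW hWh hφ W
      revert h; revert α β γ δ; unfold Cyclic; decide
    rcases this with rfl | rfl | rfl <;> assumption
  have hW0 : W = 0 := by
    refine hWh.eq_zero fun Z hZ => ?_
    obtain ⟨Y, U, hY, hU, rfl⟩ := ThreeQS.horiz_split (F := F) Z hZ
    rw [gm_add_right, gm_symm W Y, hY.2 W hWm, hW, gm_add_left, gm_smul_left, gm_smul_left,
      hφ.2 U hU, gm_nab_rxi, (inE4m_iff.1 hU).2, gm_zero_right]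
    simp
  linear_combination (norm := module) hW.symm.trans hW0

theorem InE4m.nab_lie_rxi {X Y : V} (hX : InE4m F V X) (hY : InE4m F V Y) (α : Fin 3) :
    ∇ (𝔏 X Y) (ξ α) = 0 := by
  have key : ∀ {X : V}, InE4m F V X → ∀ W : V, 𝔇 X (η α W) = η α (𝔏 X W) := by
    intro X hX W
    have h := two_mul_gm_nab_rxi (F := F) α X W
    rw [(inE4m_iff.1 hX).2, gm_zero_left, hX.1, der_zero] at h
    linear_combination -h
  refine eq_zero_of_gm (F := F) fun W => two_mul_cancel_scalar ?_
  have h := lie_leibniz (F := F) X Y W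
  have h' := congrArg (η α) h
  rw [et_add] at h'
  rw [two_mul_gm_nab_rxi, der_lie, key hY, key hX, key hX, key hY, ← key hX Y, hY.1, der_zero,
    der_zero]
  linear_combination h'

theorem Rcurv_rxi_rxi {α β δ : Fin 3} {r : ℝ} (h : 𝔏 (ξ β) (ξ α) = algebraMap ℝ F r • ξ δ)
    (X : V) :
    (2 : F) • Rcurv F V X (ξ β) (ξ α)
      = -(algebraMap ℝ F r • ∇ X (ξ δ)) - (2 : F) • ∇ (∇ X (ξ α)) (ξ β) := by
  have h1 := lie_nab_rxi h X
  rw [lie_eq_nab (ξ β) (∇ X (ξ α))] at h1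
  have h2 := congrArg (∇ X) (two_smul_nab_rxi (F := F) (V := V) α β)
  rw [lie_antisymm (ξ α), h, neg_neg, nab_const_smul_right] at h2
  have h3 : ∇ X ((2 : F) • ∇ (ξ β) (ξ α)) = (2 : F) • ∇ X (∇ (ξ β) (ξ α)) := by
    simpa only [map_ofNat] using nab_const_smul_right X 2 (∇ (ξ β) (ξ α))
  rw [h3] at h2
  rw [Rcurv, lie_antisymm X, nab_neg_left]
  linear_combination (norm := module) h2 - (2 : F) • h1

theorem Rcurv_of_inE4m {X Y : V} (hX : InE4m F V X) (hY : InE4m F V Y) (α : Fin 3) :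
    Rcurv F V X Y (ξ α) = 0 := by
  rw [Rcurv, (inE4m_iff.1 hX).2, (inE4m_iff.1 hY).2, hX.nab_lie_rxi hY, nab_zero_right,
    nab_zero_right, sub_zero, sub_zero]

theorem Rcurv_rxi_of_inE4m {X : V} (hX : InE4m F V X) (α β : Fin 3) :
    Rcurv F V X (ξ β) (ξ α) = 0 := by
  obtain ⟨r, δ, h⟩ := exists_lie_rxi (F := F) (V := V) β α
  apply two_smul_cancel (F := F)
  rw [Rcurv_rxi_rxi h, (inE4m_iff.1 hX).2, (inE4m_iff.1 hX).2, nab_zero_left]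
  simp

/-- On `E^{4l}` one has `4 ∇_{∇_X ξ_α} ξ_β = c² φ_β φ_α X`. -/
theorem four_smul_nab_nab_rxi {X : V} (hX : InE4l F V X) (α β : Fin 3) :
    (4 : F) • ∇ (∇ X (ξ α)) (ξ β) = (κ * κ) • φ β (φ α X) := by
  have h1 := congrArg (fun Z => (2 : F) • ∇ Z (ξ β)) (two_smul_nab_rxi_of_inE4l hX α)
  have h2 := two_smul_nab_rxi_of_inE4l (ThreeQS.phi_E4l (F := F) α X hX) β
  simp only [nab_smul_left, nab_neg_left] at h1
  change (2 : F) • ∇ (φ α X) (ξ β) = -(κ • φ β (φ α X)) at h2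
  linear_combination (norm := module) h1 - κ • h2

theorem Rcurv_rxi_self_of_inE4l {X : V} (hX : InE4l F V X) (α : Fin 3) :
    Rcurv F V X (ξ α) (ξ α) = algebraMap ℝ F (cc F V ^ 2 / 4) • X := by
  have h1 := Rcurv_rxi_rxi (lie_rxi_self (F := F) (V := V) α) X
  have h2 := four_smul_nab_nab_rxi hX α α
  rw [hX.1.ph_ph] at h2
  rw [map_zero] at h1
  have h4 : algebraMap ℝ F (cc F V ^ 2 / 4) * 4 = κ * κ := by
    rw [← map_ofNat (algebraMap ℝ F) 4, ← map_mul, ← map_mul]; congr 1; ring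
  apply two_smul_cancel (F := F)
  apply two_smul_cancel (F := F)
  have h5 := congrArg (fun f : F => f • X) h4
  linear_combination (norm := module) (2 : F) • h1 - h2 - h5

theorem Rcurv_rxi_of_inE4l_of_ne {X : V} (hX : InE4l F V X) {α β : Fin 3} (hne : α ≠ β) :
    Rcurv F V X (ξ β) (ξ α) = 0 := by
  apply two_smul_cancel (F := F)
  apply two_smul_cancel (F := F)
  have h2 := four_smul_nab_nab_rxi hX α β
  obtain ⟨γ, h | h⟩ := exists_cyclic_of_ne hne
  · have h1 := Rcurv_rxi_rxi (F := F) (lie_rxi_prev h) X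
    have h3 := two_smul_nab_rxi_of_inE4l hX γ
    rw [hX.1.ph_prev h] at h2
    rw [map_neg] at h1
    linear_combination (norm := module) (2 : F) • h1 - h2 + κ • h3
  · have h1 := Rcurv_rxi_rxi (F := F) (lie_rxi_next h) X
    have h3 := two_smul_nab_rxi_of_inE4l hX γ
    rw [hX.1.ph_next h] at h2
    linear_combination (norm := module) (2 : F) • h1 - h2 - κ • h3

end curvature

/-- Curvature identities in a 3-quasi-Sasakian manifold of rank
`4l+3`, and the resulting sectional curvatures `K(ξ_α, X) = 0` for
`X ∈ E^{4m}` and `K(ξ_α, X) = (c²/4)‖X‖²` for `X ∈ E^{4l}`. -/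
theorem curvature_rank_4l3 (F V : Type) [CommRing F] [Algebra ℝ F] [AddCommGroup V] [Module F V]
    [SmoothSetting F V] [ACM3 F V] [ThreeQS F V] [LeviCivita F V]
    (l : ℕ) [HasRank F V l] :
    (∀ X Y : V, InE4m F V X → InE4m F V Y → ∀ α : Fin 3,
      Rcurv F V X Y (rxi F V α) = 0) ∧
    (∀ X : V, InE4m F V X → ∀ α β : Fin 3,
      Rcurv F V X (rxi F V β) (rxi F V α) = 0) ∧
    (∀ X : V, InE4l F V X → ∀ α : Fin 3,
      Rcurv F V X (rxi F V α) (rxi F V α)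
        = algebraMap ℝ F (cc F V ^ 2 / 4) • X) ∧
    (∀ X : V, InE4l F V X → ∀ α β : Fin 3, α ≠ β →
      Rcurv F V X (rxi F V β) (rxi F V α) = 0) ∧
    (∀ X : V, InE4m F V X → ∀ α : Fin 3,
      gm F V (Rcurv F V X (rxi F V α) (rxi F V α)) X = 0) ∧
    (∀ X : V, InE4l F V X → ∀ α : Fin 3,
      gm F V (Rcurv F V X (rxi F V α) (rxi F V α)) X
        = algebraMap ℝ F (cc F V ^ 2 / 4) * gm F V X X) := by
  refine ⟨fun X Y hX hY α => Rcurv_of_inE4m hX hY α, fun X hX α β => Rcurv_rxi_of_inE4m hX α β,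
    fun X hX α => Rcurv_rxi_self_of_inE4l hX α,
    fun X hX α β hne => Rcurv_rxi_of_inE4l_of_ne hX hne, fun X hX α => ?_, fun X hX α => ?_⟩
  · rw [Rcurv_rxi_of_inE4m hX, gm_zero_left]
  · rw [Rcurv_rxi_self_of_inE4l hX, gm_smul_left]

end QS3
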